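/- (Macdonald difference operators and the Bernoulli specialization.) Fix q ∈ (0,1), integers N ≥ 1, 1 ≤ n ≤ N, k ≥ 1 and β > 0. Let x ∈ ℂ^N satisfy q^a x_i ≠ q^b x_j for all 1 ≤ i < j ≤ N and 0 ≤ a, b ≤ k. Set P(x) = ∏_{i=1}^{n} (1 + β x_i). Then for every function F : ℂ^N → ℂ: (Ã^{(β x_n, k)}_n (P·F))(x) = P(x) · (Ã^{(q β x_n, k)}_n F)(x), where in both operators the parameter (β x_n, respectively q β x_n) is evaluated at the unshifted point x. -/

import Mathlib

/-- The complex q-Pochhammer symbol `(a;q)_n = ∏_{i=0}^{n-1} (1 - a q^i)`. -/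
noncomputable def qPochC (q : ℝ) (a : ℂ) (n : ℕ) : ℂ := ∏ i ∈ Finset.range n, (1 - a * (q : ℂ) ^ i)

/-- The complex infinite q-Pochhammer symbol `(a;q)_∞`. -/
noncomputable def qPochInfC (q : ℝ) (a : ℂ) : ℂ := ∏' i : ℕ, (1 - a * (q : ℂ) ^ i)

/-- The coefficients `C_a(k,s) = (-a)^s (-a;q)_{k-s} (q;q)_k / ((q;q)_{k-s} (q;q)_s)`. -/
noncomputable def CcoC (q : ℝ) (a : ℂ) (k s : ℕ) : ℂ :=
  (-a) ^ s * qPochC q (-a) (k - s) *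
    (qPochC q (q : ℂ) k / (qPochC q (q : ℂ) (k - s) * qPochC q (q : ℂ) s))

/-- The `t = 0` Macdonald first difference operator
`(D_n F)(x) = ∑_{i=1}^{n} (∏_{j≤n, j≠i} (-x_j)/(x_i - x_j)) F(x_1,…,q x_i,…,x_N)`;
`n = 0` gives the zero operator. -/
noncomputable def Dop {N : ℕ} (q : ℝ) (n : ℕ) (F : (Fin N → ℂ) → ℂ) (x : Fin N → ℂ) : ℂ :=
  ∑ i ∈ Finset.univ.filter (fun i : Fin N => (i : ℕ) < n),
    (∏ j ∈ Finset.univ.filter (fun j : Fin N => (j : ℕ) < n ∧ j ≠ i), (-(x j)) / (x i - x j))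
      * F (Function.update x i ((q : ℂ) * x i))

/-- `(Ã^{(a,k)}_n F)(x) = ∑_{s=0}^{k} C_a(k,s) ((D_{n-1})^s (D_n)^{k-s} F)(x)`. -/
noncomputable def Atilde {N : ℕ} (q : ℝ) (a : ℂ) (n k : ℕ) (F : (Fin N → ℂ) → ℂ)
    (x : Fin N → ℂ) : ℂ :=
  ∑ s ∈ Finset.range (k + 1), CcoC q a k s * ((Dop q (n - 1))^[s] ((Dop q n)^[k - s] F)) x

open Finset

/-- The coefficient of the `i`-th shift in `Dop`. -/
noncomputable def shiftCoeff {N : ℕ} (n : ℕ) (i : Fin N) (x : Fin N → ℂ) : ℂ :=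
  ∏ j ∈ univ.filter (fun j : Fin N => (j : ℕ) < n ∧ j ≠ i), (-(x j)) / (x i - x j)

/-- The operator `∑_i c_i φ(x_i) T_i`, where `Dop = ∑_i c_i T_i`. -/
noncomputable def weightedDop {N : ℕ} (q : ℝ) (n : ℕ) (φ : ℂ → ℂ) (F : (Fin N → ℂ) → ℂ)
    (x : Fin N → ℂ) : ℂ :=
  ∑ i ∈ univ.filter (fun i : Fin N => (i : ℕ) < n),
    shiftCoeff n i x * φ (x i) * F (Function.update x i ((q : ℂ) * x i))

/-- The points whose first `k` shifts avoid the poles of the difference operators. -/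
def nonresonant (N : ℕ) (q : ℝ) (k : ℕ) : Set (Fin N → ℂ) :=
  {x | ∀ i j : Fin N, i ≠ j → ∀ A B : ℕ, A ≤ k → B ≤ k → (q : ℂ) ^ A * x i ≠ (q : ℂ) ^ B * x j}

section

variable {N : ℕ} {q : ℝ} {n k m : ℕ} {x : Fin N → ℂ}

theorem nonresonant_anti (h : k ≤ m) : nonresonant N q m ⊆ nonresonant N q k :=
  fun _ hx i j hij A B hA hB => hx i j hij A B (hA.trans h) (hB.trans h)

theorem nonresonant.ne (hx : x ∈ nonresonant N q k) {i j : Fin N} (h : i ≠ j) : x i ≠ x j := by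
  simpa using hx i j h 0 0 (Nat.zero_le _) (Nat.zero_le _)

theorem nonresonant.update (hx : x ∈ nonresonant N q (k + 1)) (i : Fin N) :
    Function.update x i ((q : ℂ) * x i) ∈ nonresonant N q k := by
  intro a b hab A B hA hB
  by_cases ha : a = i
  · subst ha
    rw [Function.update_self, Function.update_of_ne hab.symm, ← mul_assoc, ← pow_succ]
    exact hx a b hab _ _ (by omega) (by omega)
  · by_cases hb : b = i
    · subst hb
      rw [Function.update_self, Function.update_of_ne hab, ← mul_assoc, ← pow_succ]
      exact hx a b hab _ _ (by omega) (by omega)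
    · rw [Function.update_of_ne ha, Function.update_of_ne hb]
      exact hx a b hab _ _ (by omega) (by omega)

theorem Dop_eq_weightedDop (F : (Fin N → ℂ) → ℂ) : Dop q n F = weightedDop q n (fun _ => 1) F := by
  funext x
  simp [Dop, weightedDop, shiftCoeff]

theorem Dop_congr {F G : (Fin N → ℂ) → ℂ} (h : Set.EqOn F G (nonresonant N q k)) :
    Set.EqOn (Dop q n F) (Dop q n G) (nonresonant N q (k + 1)) := by
  intro x hx
  refine sum_congr rfl fun i _ => ?_
  rw [h (nonresonant.update hx i)]

theorem Dop_iterate_congr {F G : (Fin N → ℂ) → ℂ} (h : Set.EqOn F G (nonresonant N q k)) (m : ℕ) :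
    Set.EqOn ((Dop q n)^[m] F) ((Dop q n)^[m] G) (nonresonant N q (k + m)) := by
  induction m with
  | zero => exact h
  | succ m ih =>
    rw [Function.iterate_succ_apply', Function.iterate_succ_apply']
    exact Dop_congr ih

theorem Dop_add (F G : (Fin N → ℂ) → ℂ) : Dop q n (F + G) = Dop q n F + Dop q n G := by
  funext x
  simp [Dop, mul_add, sum_add_distrib]

theorem Dop_smul (c : ℂ) (F : (Fin N → ℂ) → ℂ) : Dop q n (c • F) = c • Dop q n F := by
  funext x
  simp only [Dop, Pi.smul_apply, smul_eq_mul, mul_sum]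
  exact sum_congr rfl fun i _ => by ring

theorem Dop_iterate_add (F G : (Fin N → ℂ) → ℂ) (m : ℕ) :
    (Dop q n)^[m] (F + G) = (Dop q n)^[m] F + (Dop q n)^[m] G := by
  induction m with
  | zero => rfl
  | succ m ih => simp only [Function.iterate_succ_apply', ih, Dop_add]

theorem Dop_iterate_smul (c : ℂ) (F : (Fin N → ℂ) → ℂ) (m : ℕ) :
    (Dop q n)^[m] (c • F) = c • (Dop q n)^[m] F := by
  induction m with
  | zero => rfl
  | succ m ih => simp only [Function.iterate_succ_apply', ih, Dop_smul]

theorem Dop_coord_mul {p : Fin N} (hp : n ≤ p) (F : (Fin N → ℂ) → ℂ) :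
    Dop q n (fun w => w p * F w) = fun w => w p * Dop q n F w := by
  funext x
  simp only [Dop, mul_sum]
  refine sum_congr rfl fun i hi => ?_
  have hpi : p ≠ i := by
    rintro rfl
    simp only [mem_filter, mem_univ, true_and] at hi
    omega
  rw [Function.update_of_ne hpi]
  ring

theorem Dop_iterate_coord_mul {p : Fin N} (hp : n ≤ p) (F : (Fin N → ℂ) → ℂ) (m : ℕ) :
    (Dop q n)^[m] (fun w => w p * F w) = fun w => w p * (Dop q n)^[m] F w := by
  induction m with
  | zero => rfl
  | succ m ih => simp only [Function.iterate_succ_apply', ih, Dop_coord_mul hp]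

theorem shiftCoeff_eq_mul {i j : Fin N} (hj : (j : ℕ) < n) (hij : i ≠ j) :
    shiftCoeff n i x = (-(x j)) / (x i - x j) *
      ∏ l ∈ univ.filter (fun l : Fin N => (l : ℕ) < n ∧ l ≠ i ∧ l ≠ j), (-(x l)) / (x i - x l) := by
  rw [shiftCoeff, ← mul_prod_erase (a := j)]
  · congr 2
    ext l
    simp only [mem_erase, mem_filter, mem_univ, true_and]
    tauto
  · simpa using ⟨hj, hij.symm⟩

theorem shiftCoeff_update {i j : Fin N} (hi : (i : ℕ) < n) (hij : i ≠ j) (c : ℂ) :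
    shiftCoeff n j (Function.update x i c) = (-c) / (x j - c) *
      ∏ l ∈ univ.filter (fun l : Fin N => (l : ℕ) < n ∧ l ≠ i ∧ l ≠ j), (-(x l)) / (x j - x l) := by
  rw [shiftCoeff_eq_mul hi hij.symm, Function.update_self, Function.update_of_ne hij.symm]
  congr 1
  refine prod_congr ?_ ?_
  · ext l
    simp only [mem_filter, mem_univ, true_and]
    tauto
  · intro l hl
    simp only [mem_filter, mem_univ, true_and] at hl
    rw [Function.update_of_ne hl.2.1]

/-- The operators `e_0 = ∑ c_i T_i` and `e_1 = ∑ c_i x_i T_i` satisfy `e_0 e_1 = q e_1 e_0`. -/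
theorem Dop_weightedDop_id (hx : x ∈ nonresonant N q 1) (F : (Fin N → ℂ) → ℂ) :
    Dop q n (weightedDop q n id F) x = q * weightedDop q n id (Dop q n F) x := by
  set S := univ.filter (fun i : Fin N => (i : ℕ) < n) with hS
  set f : Fin N → Fin N → ℂ := fun i j =>
    shiftCoeff n i x * shiftCoeff n j (Function.update x i (q * x i)) *
      (Function.update x i (q * x i) j - q * x i) *
      F (Function.update (Function.update x i (q * x i)) j
        (q * Function.update x i (q * x i) j)) with hf
  have hanti : ∀ i ∈ S, ∀ j ∈ S, f i j = - f j i := by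
    intro i hi j hj
    simp only [hS, mem_filter, mem_univ, true_and] at hi hj
    by_cases hij : i = j
    · subst hij
      simp [hf]
    · have h1 : x i - x j ≠ 0 := sub_ne_zero.2 (nonresonant.ne hx hij)
      have h3 : x j - q * x i ≠ 0 :=
        sub_ne_zero.2 (by simpa using hx j i (Ne.symm hij) 0 1 (by omega) le_rfl)
      have h4 : x i - q * x j ≠ 0 :=
        sub_ne_zero.2 (by simpa using hx i j hij 0 1 (by omega) le_rfl)
      simp only [hf]
      rw [shiftCoeff_update hi hij, shiftCoeff_update hj (Ne.symm hij), shiftCoeff_eq_mul hj hij,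
        shiftCoeff_eq_mul hi (Ne.symm hij), Function.update_of_ne (Ne.symm hij),
        Function.update_of_ne hij, Function.update_comm hij]
      have hset : univ.filter (fun l : Fin N => (l : ℕ) < n ∧ l ≠ j ∧ l ≠ i) =
          univ.filter (fun l : Fin N => (l : ℕ) < n ∧ l ≠ i ∧ l ≠ j) := by
        ext l
        simp only [mem_filter, mem_univ, true_and]
        tauto
      rw [hset]
      have h5 : x j - x i = -(x i - x j) := by ring
      rw [h5]
      generalize F _ = c, ∏ l ∈ _, (-(x l)) / (x i - x l) = a,
        ∏ l ∈ _, (-(x l)) / (x j - x l) = b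
      generalize hu : x j - q * x i = u at *
      generalize hv : x i - q * x j = v at *
      field_simp
  have hzero : ∑ i ∈ S, ∑ j ∈ S, f i j = 0 := by
    have h : ∑ i ∈ S, ∑ j ∈ S, f i j = - ∑ i ∈ S, ∑ j ∈ S, f i j := by
      conv_lhs => rw [sum_comm]
      simp only [← sum_neg_distrib]
      exact sum_congr rfl fun i hi => sum_congr rfl fun j hj => hanti j hj i hi
    exact self_eq_neg.1 h
  rw [← sub_eq_zero, ← hzero]
  simp only [Dop_eq_weightedDop, weightedDop, mul_sum, ← sum_sub_distrib, ← hS]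
  refine sum_congr rfl fun i _ => sum_congr rfl fun j _ => ?_
  simp only [hf, id]
  ring

theorem Dop_iterate_weightedDop_id (F : (Fin N → ℂ) → ℂ) (m : ℕ) :
    Set.EqOn ((Dop q n)^[m] (weightedDop q n id F))
      ((q : ℂ) ^ m • weightedDop q n id ((Dop q n)^[m] F)) (nonresonant N q m) := by
  induction m with
  | zero => intro x _; simp
  | succ m ih =>
    intro x hx
    rw [Function.iterate_succ_apply', Dop_congr ih hx, Dop_smul, Pi.smul_apply,
      Dop_weightedDop_id (nonresonant_anti (by omega) hx), Function.iterate_succ_apply' _ m F]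
    simp only [Pi.smul_apply, smul_eq_mul]
    ring

theorem weightedDop_id_eq (hx : x ∈ nonresonant N q k) {p : Fin N} (F : (Fin N → ℂ) → ℂ) :
    weightedDop q (p + 1) id F x = x p * (Dop q (p + 1) F x - Dop q p F x) := by
  have hset : univ.filter (fun i : Fin N => (i : ℕ) < p + 1) =
      insert p (univ.filter (fun i : Fin N => (i : ℕ) < p)) := by
    ext i
    simp only [mem_filter, mem_univ, true_and, mem_insert, Fin.ext_iff]
    omega
  have hp : p ∉ univ.filter (fun i : Fin N => (i : ℕ) < p) := by simp
  simp only [Dop_eq_weightedDop, weightedDop, hset, sum_insert hp]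
  rw [add_sub_assoc, ← sum_sub_distrib, mul_add, mul_sum]
  congr 1
  · simp only [id]; ring
  · refine sum_congr rfl fun i hi => ?_
    simp only [mem_filter, mem_univ, true_and] at hi
    have hip : i ≠ p := by rintro rfl; omega
    have h1 : x i - x p ≠ 0 := sub_ne_zero.2 (nonresonant.ne hx hip)
    have h2 : shiftCoeff (p + 1) i x = (-(x p)) / (x i - x p) * shiftCoeff p i x := by
      rw [shiftCoeff_eq_mul (Nat.lt_succ_self _) hip, shiftCoeff]
      congr 2
      ext l
      simp only [mem_filter, mem_univ, true_and, Fin.ext_iff, ne_eq]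
      omega
    rw [h2]
    simp only [id]
    field_simp
    ring

theorem weightedDop_affine (b : ℂ) (F : (Fin N → ℂ) → ℂ) :
    weightedDop q n (fun t => 1 + b * t) F = Dop q n F + b • weightedDop q n id F := by
  funext x
  simp only [Dop_eq_weightedDop, weightedDop, Pi.add_apply, Pi.smul_apply, smul_eq_mul, mul_sum,
    ← sum_add_distrib]
  exact sum_congr rfl fun i _ => by simp only [id]; ring

theorem qPochC_succ (a : ℂ) (m : ℕ) : qPochC q a (m + 1) = qPochC q a m * (1 - a * (q : ℂ) ^ m) :=
  prod_range_succ _ _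

theorem qPochC_zero (a : ℂ) : qPochC q a 0 = 1 := prod_range_zero _

theorem one_sub_pow_ne_zero (hq : q ∈ Set.Ioo (0 : ℝ) 1) (m : ℕ) : 1 - (q : ℂ) * (q : ℂ) ^ m ≠ 0 := by
  rw [sub_ne_zero, ← pow_succ']
  exact_mod_cast (pow_lt_one₀ hq.1.le hq.2 (Nat.succ_ne_zero m)).ne'

theorem qPochC_self_ne_zero (hq : q ∈ Set.Ioo (0 : ℝ) 1) (m : ℕ) : qPochC q (q : ℂ) m ≠ 0 :=
  prod_ne_zero_iff.2 fun i _ => one_sub_pow_ne_zero hq i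

theorem CcoC_succ_succ (hq : q ∈ Set.Ioo (0 : ℝ) 1) (a : ℂ) {s : ℕ} (hs : s < k) :
    CcoC q a (k + 1) (s + 1) = CcoC q a k (s + 1) * (1 + a * (q : ℂ) ^ (k - (s + 1))) -
      CcoC q a k s * (a * (q : ℂ) ^ (k - s)) := by
  obtain ⟨d, rfl⟩ := Nat.exists_eq_add_of_lt hs
  have e1 : s + d + 1 + 1 - (s + 1) = d + 1 := by omega
  have e2 : s + d + 1 - (s + 1) = d := by omega
  have e3 : s + d + 1 - s = d + 1 := by omega
  simp only [CcoC, e1, e2, e3]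
  rw [qPochC_succ _ (s + d + 1), qPochC_succ _ d, qPochC_succ _ s, qPochC_succ _ d]
  have h1 := qPochC_self_ne_zero hq d
  have h2 := qPochC_self_ne_zero hq s
  have h3 := one_sub_pow_ne_zero hq d
  have h4 := one_sub_pow_ne_zero hq s
  rw [pow_succ (q : ℂ) (s + d), pow_succ (q : ℂ) d, pow_add (q : ℂ) s d]
  generalize (q : ℂ) ^ d = u at *
  generalize (q : ℂ) ^ s = v at *
  generalize hA : 1 - (q : ℂ) * u = A at *
  generalize hB : 1 - (q : ℂ) * v = B at *
  field_simp
  rw [← hA, ← hB]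
  ring

theorem CcoC_zero (hq : q ∈ Set.Ioo (0 : ℝ) 1) (a : ℂ) : CcoC q a k 0 = qPochC q (-a) k := by
  simp [CcoC, qPochC_zero, qPochC_self_ne_zero hq]

theorem CcoC_self (hq : q ∈ Set.Ioo (0 : ℝ) 1) (a : ℂ) : CcoC q a k k = (-a) ^ k := by
  simp [CcoC, qPochC_zero, qPochC_self_ne_zero hq]

theorem sum_CcoC_succ (hq : q ∈ Set.Ioo (0 : ℝ) 1) (a : ℂ) (X : ℕ → ℕ → ℂ) :
    ∑ s ∈ range (k + 1 + 1), CcoC q a (k + 1) s * X s (k + 1 - s) =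
      ∑ s ∈ range (k + 1), CcoC q a k s *
        ((1 + a * (q : ℂ) ^ (k - s)) * X s (k - s + 1) -
          a * (q : ℂ) ^ (k - s) * X (s + 1) (k - s)) := by
  simp only [mul_sub, sum_sub_distrib]
  rw [sum_range_succ, sum_range_succ', sum_range_succ' _ k,
    sum_range_succ (fun s => CcoC q a k s * (a * (q : ℂ) ^ (k - s) * X (s + 1) (k - s)))]
  have h : ∑ s ∈ range k, CcoC q a (k + 1) (s + 1) * X (s + 1) (k + 1 - (s + 1)) =
      ∑ s ∈ range k, CcoC q a k (s + 1) *
        ((1 + a * (q : ℂ) ^ (k - (s + 1))) * X (s + 1) (k - (s + 1) + 1)) -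
      ∑ s ∈ range k, CcoC q a k s * (a * (q : ℂ) ^ (k - s) * X (s + 1) (k - s)) := by
    rw [← sum_sub_distrib]
    refine sum_congr rfl fun s hs => ?_
    have hs' := mem_range.1 hs
    have e1 : k - (s + 1) + 1 = k - s := by omega
    have e2 : k + 1 - (s + 1) = k - s := by omega
    rw [CcoC_succ_succ hq a hs', e1, e2]
    ring
  rw [h]
  simp only [CcoC_zero hq, CcoC_self hq, qPochC_succ, Nat.sub_self, Nat.sub_zero, pow_zero]
  ring

/-- `Ã^{(b x_n, k)}_n` is the `k`-th power of `∑_i c_i (1 + b x_i) T_i`. -/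
theorem Atilde_eq_iterate (hq : q ∈ Set.Ioo (0 : ℝ) 1) (p : Fin N) (b : ℂ) (k : ℕ)
    (F : (Fin N → ℂ) → ℂ) {x : Fin N → ℂ} (hx : x ∈ nonresonant N q k) :
    Atilde q (b * x p) (p + 1) k F x = (weightedDop q (p + 1) (fun t => 1 + b * t))^[k] F x := by
  induction k generalizing F with
  | zero => simp [Atilde, CcoC, qPochC_zero]
  | succ k ih =>
    rw [Function.iterate_succ_apply, ← ih _ (nonresonant_anti (Nat.le_succ k) hx), Atilde, Atilde,
      Nat.add_sub_cancel,
      sum_CcoC_succ hq _ fun s r => (Dop q p)^[s] ((Dop q (p + 1))^[r] F) x]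
    refine sum_congr rfl fun s hs => ?_
    have hs' := mem_range.1 hs
    congr 1
    set G := (Dop q (p + 1))^[k - s] F with hG
    have hDG : (Dop q (p + 1))^[k - s] (Dop q (p + 1) F) = Dop q (p + 1) G := by
      rw [hG, ← Function.iterate_succ_apply, Function.iterate_succ_apply']
    have key : Set.EqOn ((Dop q (p + 1))^[k - s] (weightedDop q (p + 1) id F))
        ((q : ℂ) ^ (k - s) • fun w => w p * (Dop q (p + 1) G + (-1 : ℂ) • Dop q p G) w)
        (nonresonant N q (k - s)) := by
      intro w hw
      rw [Dop_iterate_weightedDop_id F _ hw, Pi.smul_apply, weightedDop_id_eq hw]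
      simp only [Pi.smul_apply, Pi.add_apply, smul_eq_mul, hG]
      ring
    have hx' : x ∈ nonresonant N q (k - s + s) := nonresonant_anti (by omega) hx
    rw [weightedDop_affine, Dop_iterate_add, Dop_iterate_smul, Dop_iterate_add, Dop_iterate_smul,
      Pi.add_apply, Pi.smul_apply, Dop_iterate_congr key s hx', Dop_iterate_smul,
      Dop_iterate_coord_mul le_rfl, Dop_iterate_add, Dop_iterate_smul,
      hDG, Function.iterate_succ_apply' _ (k - s) F, Function.iterate_succ_apply _ s]
    simp only [Pi.smul_apply, Pi.add_apply, smul_eq_mul, hG]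
    ring

theorem weightedDop_prod_mul (b : ℂ) (F : (Fin N → ℂ) → ℂ) :
    weightedDop q n (fun t => 1 + b * t)
        (fun w => (∏ i ∈ univ.filter (fun i : Fin N => (i : ℕ) < n), (1 + b * w i)) * F w) =
      fun w => (∏ i ∈ univ.filter (fun i : Fin N => (i : ℕ) < n), (1 + b * w i)) *
        weightedDop q n (fun t => 1 + q * b * t) F w := by
  funext x
  simp only [weightedDop, mul_sum]
  refine sum_congr rfl fun i hi => ?_
  rw [← mul_prod_erase _ _ hi, ← mul_prod_erase _ _ hi, Function.update_self]
  have h : ∏ j ∈ (univ.filter (fun i : Fin N => (i : ℕ) < n)).erase i,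
      (1 + b * Function.update x i (q * x i) j) =
      ∏ j ∈ (univ.filter (fun i : Fin N => (i : ℕ) < n)).erase i, (1 + b * x j) :=
    prod_congr rfl fun j hj => by rw [Function.update_of_ne (ne_of_mem_erase hj)]
  rw [h]
  ring

theorem weightedDop_iterate_prod_mul (b : ℂ) (F : (Fin N → ℂ) → ℂ) (k : ℕ) :
    (weightedDop q n (fun t => 1 + b * t))^[k]
        (fun w => (∏ i ∈ univ.filter (fun i : Fin N => (i : ℕ) < n), (1 + b * w i)) * F w) =
      fun w => (∏ i ∈ univ.filter (fun i : Fin N => (i : ℕ) < n), (1 + b * w i)) *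
        (weightedDop q n (fun t => 1 + q * b * t))^[k] F w := by
  induction k generalizing F with
  | zero => rfl
  | succ k ih => rw [Function.iterate_succ_apply, weightedDop_prod_mul, ih]; rfl

end

theorem stmt_17 (q : ℝ) (hq : q ∈ Set.Ioo (0:ℝ) 1) (N : ℕ) (hN : 1 ≤ N)
    (n : ℕ) (hn1 : 1 ≤ n) (hnN : n ≤ N) (k : ℕ) (hk : 1 ≤ k)
    (β : ℝ) (hβ : 0 < β)
    (x : Fin N → ℂ)
    (hx : ∀ i j : Fin N, i < j → ∀ A B : ℕ, A ≤ k → B ≤ k →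
      (q : ℂ) ^ A * x i ≠ (q : ℂ) ^ B * x j)
    (F : (Fin N → ℂ) → ℂ) :
    Atilde q ((β : ℂ) * x ⟨n - 1, by omega⟩) n k
        (fun w =>
          (∏ i ∈ Finset.univ.filter (fun i : Fin N => (i : ℕ) < n),
            (1 + (β : ℂ) * w i)) * F w) x
      = (∏ i ∈ Finset.univ.filter (fun i : Fin N => (i : ℕ) < n), (1 + (β : ℂ) * x i))
        * Atilde q ((q : ℂ) * ((β : ℂ) * x ⟨n - 1, by omega⟩)) n k F x := by
  have hx' : x ∈ nonresonant N q k := by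
    intro i j hij A B hA hB
    rcases lt_or_gt_of_ne hij with h | h
    · exact hx i j h A B hA hB
    · exact (hx j i h B A hB hA).symm
  obtain ⟨m, rfl⟩ : ∃ m, n = m + 1 := ⟨n - 1, by omega⟩
  have h := fun b G => Atilde_eq_iterate hq ⟨m, by omega⟩ b k G hx'
  simp only [Nat.add_sub_cancel]
  rw [← mul_assoc]
  exact (h _ _).trans ((congrFun (weightedDop_iterate_prod_mul _ F k) x).trans
    (congrArg _ (h _ F).symm))
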